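/- arXiv:2403.15588 — 2 statements merged into one kernel-verified Lean document; each statement's English description precedes it below -/
import Mathlib

section
/- In the RIS-free uplink SINR model, assume additionally that κ_u > 0. Then SINR_k^{(w)}(B) converges to 1/κ_u² as B → ∞. -/
open Filter

/-- The RIS-free uplink SINR of user `k` (equation (18) of the paper), as a function of
the (real) number of antennas `B`: `K, L` are the numbers of users and APs,
`p` the transmit powers, `γ` the path-loss factors, `σsq` the noise power and
`κu, κb` the transmitter/receiver hardware-impairment coefficients. -/
noncomputable def SINRw (K L : ℕ) (p : Fin K → ℝ) (γ : Fin L → Fin K → ℝ)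
    (σsq κu κb : ℝ) (k : Fin K) (B : ℝ) : ℝ :=
  (p k * ((∑ l, γ l k * B) ^ 2 + ∑ l, (γ l k) ^ 2 * B)) /
    (p k * κu ^ 2 * (∑ l, γ l k * B) ^ 2
      + ∑ l, γ l k * B * (σsq - p k * γ l k)
      + (1 + κb ^ 2) * (1 + κu ^ 2) * ∑ i, ∑ l, p i * γ l k * γ l i * B)

/-- A ratio of quadratics without constant terms tends to the ratio of leading coefficients. -/
theorem tendsto_quadratic_div_quadratic_atTop (a b c d : ℝ) (hc : c ≠ 0) :
    Tendsto (fun x : ℝ => (a * x ^ 2 + b * x) / (c * x ^ 2 + d * x)) atTop (nhds (a / c)) := by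
  have affine_inv (u v : ℝ) : Tendsto (fun x : ℝ => u + v * x⁻¹) atTop (nhds u) := by
    simpa using (tendsto_inv_atTop_zero.const_mul v).const_add u
  refine ((affine_inv a b).div (affine_inv c d) hc).congr' ?_
  filter_upwards [eventually_gt_atTop 0] with x hx
  have factor (u v : ℝ) : u * x ^ 2 + v * x = x ^ 2 * (u + v * x⁻¹) := by
    field_simp
  simp only [Pi.div_apply, factor]
  rw [mul_div_mul_left _ _ (by positivity)]

/-- in the RIS-free uplink SINR model with `κ_u > 0`, the SINR of user
`k` converges to `1/κ_u²` as the number of antennas `B → ∞`. -/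
theorem sinr_ris_free_tendsto_inv_kappa_sq
    (K L : ℕ) (hK : 0 < K) (hL : 0 < L) (k : Fin K)
    (p : Fin K → ℝ) (hp : ∀ i, 0 < p i)
    (γ : Fin L → Fin K → ℝ) (hγ : ∀ l i, 0 < γ l i)
    (σsq : ℝ) (hσ : 0 < σsq)
    (κu κb : ℝ) (hκu : 0 ≤ κu) (hκb : 0 ≤ κb) (hκu' : 0 < κu) :
    Tendsto (fun B => SINRw K L p γ σsq κu κb k B) atTop (nhds (1 / κu ^ 2)) := by
  have : Nonempty (Fin L) := ⟨⟨0, hL⟩⟩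
  have hS : 0 < ∑ l, γ l k := Finset.sum_pos (fun l _ => hγ l k) Finset.univ_nonempty
  have hpk := hp k
  have key := tendsto_quadratic_div_quadratic_atTop
    (p k * (∑ l, γ l k) ^ 2) (p k * ∑ l, γ l k ^ 2)
    (p k * κu ^ 2 * (∑ l, γ l k) ^ 2)
    (∑ l, γ l k * (σsq - p k * γ l k)
      + (1 + κb ^ 2) * (1 + κu ^ 2) * ∑ i, ∑ l, p i * γ l k * γ l i)
    (by positivity)
  have hlim : p k * (∑ l, γ l k) ^ 2 / (p k * κu ^ 2 * (∑ l, γ l k) ^ 2) = 1 / κu ^ 2 := by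
    field_simp
  rw [hlim] at key
  refine key.congr fun B => ?_
  have hnoise : ∑ l, γ l k * B * (σsq - p k * γ l k)
      = (∑ l, γ l k * (σsq - p k * γ l k)) * B := by
    rw [Finset.sum_mul]
    exact Finset.sum_congr rfl fun l _ => by ring
  simp only [SINRw, hnoise, ← Finset.sum_mul]
  congr 1 <;> ring
end

section
/- In the RIS-free uplink SINR model, fix p > 0 and replace every transmit power by the scaled power p_i = p/B for all users i (power scaling law with the number of antennas). Then, as B → ∞, the resulting SINR_k^{(w)}(B) (with p_i = p/B substituted in the defining formula) converges to p·(Σ_{l=1}^L γ_{l,k})² / ( p·κ_u²·(Σ_{l=1}^L γ_{l,k})² + σ²·Σ_{l=1}^L γ_{l,k} ). -/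
open Filter

/-- With every power equal to `p / B`, dividing numerator and denominator of the SINR by `B`
leaves an expression that depends on `B` only through `B⁻¹`. -/
lemma SINRw_scaled_eq (K L : ℕ) (γ : Fin L → Fin K → ℝ) (p σsq κu κb : ℝ) (k : Fin K)
    {B : ℝ} (hB : B ≠ 0) :
    SINRw K L (fun _ => p / B) γ σsq κu κb k B =
      (p * (∑ l, γ l k) ^ 2 + p * (∑ l, γ l k ^ 2) * B⁻¹) /
        (p * κu ^ 2 * (∑ l, γ l k) ^ 2 + σsq * ∑ l, γ l k
          + ((1 + κb ^ 2) * (1 + κu ^ 2) * (p * ∑ i, ∑ l, γ l k * γ l i)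
            - p * ∑ l, γ l k ^ 2) * B⁻¹) := by
  have noise_sum : ∑ l, γ l k * B * (σsq - p / B * γ l k)
      = B * (σsq * ∑ l, γ l k) - p * ∑ l, γ l k ^ 2 := by
    simp only [Finset.mul_sum, ← Finset.sum_sub_distrib]
    refine Finset.sum_congr rfl fun l _ => ?_
    field_simp
  have interference_sum : ∑ i, ∑ l, p / B * γ l k * γ l i * B
      = p * ∑ i, ∑ l, γ l k * γ l i := by
    simp only [Finset.mul_sum]
    refine Finset.sum_congr rfl fun i _ => Finset.sum_congr rfl fun l _ => ?_
    field_simp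
  rw [SINRw, noise_sum, interference_sum, ← Finset.sum_mul, ← Finset.sum_mul,
    ← mul_div_mul_left _ (_ + _ * B⁻¹) hB]
  congr 1 <;> field_simp
  ring

/-- power scaling law with the number of antennas: in the RIS-free uplink
SINR model with every transmit power scaled as `p_i = p/B`, the SINR of user `k`
converges, as `B → ∞`, to `p(Σ_l γ_{l,k})² / (pκ_u²(Σ_l γ_{l,k})² + σ²Σ_l γ_{l,k})`. -/
theorem sinr_ris_free_power_scaling_antennas
    (K L : ℕ) (hK : 0 < K) (hL : 0 < L) (k : Fin K)
    (p : ℝ) (hp : 0 < p)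
    (γ : Fin L → Fin K → ℝ) (hγ : ∀ l i, 0 < γ l i)
    (σsq : ℝ) (hσ : 0 < σsq)
    (κu κb : ℝ) (hκu : 0 ≤ κu) (hκb : 0 ≤ κb) :
    Tendsto (fun B => SINRw K L (fun _ => p / B) γ σsq κu κb k B) atTop
      (nhds (p * (∑ l, γ l k) ^ 2 /
        (p * κu ^ 2 * (∑ l, γ l k) ^ 2 + σsq * ∑ l, γ l k))) := by
  have : Nonempty (Fin L) := ⟨⟨0, hL⟩⟩
  have gain_pos : 0 < ∑ l, γ l k :=
    Finset.sum_pos (fun l _ => hγ l k) Finset.univ_nonempty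
  have tendsto_add_mul_inv (a c : ℝ) : Tendsto (fun B : ℝ => a + c * B⁻¹) atTop (nhds a) := by
    simpa using (tendsto_inv_atTop_zero.const_mul c).const_add a
  rw [tendsto_congr' ((eventually_ne_atTop 0).mono fun B hB =>
    SINRw_scaled_eq K L γ p σsq κu κb k hB)]
  exact (tendsto_add_mul_inv _ _).div (tendsto_add_mul_inv _ _) (by positivity)
end
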